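/- Let K be a commutative ring and let T be a K-linear triangulated category (a pretriangulated category satisfying the octahedral axiom) in which idempotents split and such that for every object X the endomorphism ring End_T(X) is both left and right artinian. Then for any two objects M and N of T the following are equivalent: (1) there exist an object Z_l, a morphism u_l : Z_l → M and a nilpotent endomorphism v_l : Z_l → Z_l such that the morphism Z_l → Z_l ⊕ M with components v_l and u_l fits into a distinguished triangle Z_l → Z_l ⊕ M → N → Z_l[1]; (2) there exist an object Z_r, a morphism u_r : M → Z_r and a nilpotent endomorphism v_r : Z_r → Z_r such that the morphism M ⊕ Z_r → Z_r with components u_r and v_r fits into a distinguished triangle N → M ⊕ Z_r → Z_r → N[1]. -/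

import Mathlib

open CategoryTheory CategoryTheory.Limits CategoryTheory.Pretriangulated

section DrazinInverse

lemma IsArtinianRing.exists_pow_eq_mul_pow {R : Type*} [Ring R] [IsArtinianRing R] (v : R) :
    ∃ n, ∀ m, n ≤ m → ∃ y, v ^ n = y * v ^ m := by
  obtain ⟨n, hn⟩ := IsArtinian.monotone_stabilizes (R := R) (M := R)
    ⟨fun k => OrderDual.toDual (Submodule.span R {v ^ k}), fun a b hab => by
      refine OrderDual.toDual_le_toDual.2 (Submodule.span_le.2 ?_)
      rintro _ rfl
      refine Submodule.mem_span_singleton.2 ⟨v ^ (b - a), ?_⟩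
      rw [smul_eq_mul, ← pow_add, Nat.sub_add_cancel hab]⟩
  refine ⟨n, fun m hm => ?_⟩
  have hmem : v ^ n ∈ Submodule.span R {v ^ m} := by
    have h : Submodule.span R {v ^ n} = Submodule.span R {v ^ m} := hn m hm
    exact h ▸ Submodule.mem_span_singleton_self _
  obtain ⟨y, hy⟩ := Submodule.mem_span_singleton.1 hmem
  exact ⟨y, hy.symm⟩

/-- If `v ^ (n + 1)` is divisible by its square on both sides, then `v` has a Drazin inverse. -/
lemma exists_drazin_inverse_of_eq_mul {R : Type*} [Ring R] {v x y : R} {n : ℕ}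
    (hx : v ^ (n + 1) = v ^ (n + 1) * v ^ (n + 1) * x)
    (hy : v ^ (n + 1) = y * (v ^ (n + 1) * v ^ (n + 1))) :
    ∃ b, v * b = b * v ∧ b * v * b = b ∧ IsNilpotent (v - v * v * b) := by
  have hw₁ : v * v ^ n = v ^ (n + 1) := (pow_succ' v n).symm
  have hw₂ : v ^ n * v = v ^ (n + 1) := (pow_succ v n).symm
  generalize hw : v ^ (n + 1) = w at hx hy hw₁ hw₂
  generalize v ^ n = w' at hw₁ hw₂
  have hvw : v * w = w * v := by rw [← hw]; exact (Commute.refl v).pow_right _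
  obtain ⟨e, he⟩ : ∃ e, e = w * x := ⟨_, rfl⟩
  have he' : e = y * w := by
    rw [he]; nth_rw 1 [hy]; rw [mul_assoc, ← hx]
  have hew : e * w = w := by rw [he', mul_assoc, ← hy]
  have hwe : w * e = w := by rw [he, ← mul_assoc, ← hx]
  have hee : e * e = e := by nth_rw 2 [he]; rw [← mul_assoc, hew, ← he]
  have hev : e * v * e = v * e := by
    calc e * v * e = e * (v * w) * x := by nth_rw 2 [he]; simp only [mul_assoc]
      _ = v * e := by rw [hvw, ← mul_assoc, hew, ← hvw, he, mul_assoc]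
  have hve : e * v * e = e * v := by
    calc e * v * e = y * (w * v) * e := by nth_rw 1 [he']; simp only [mul_assoc]
      _ = e * v := by rw [← hvw, mul_assoc, mul_assoc, hwe, hvw, he', mul_assoc]
  have hc : v * e = e * v := hev.symm.trans hve
  have h₁ : v * (e * w' * x * e) = e := by
    calc v * (e * w' * x * e) = (v * e) * w' * x * e := by simp only [mul_assoc]
      _ = e * (v * w') * x * e := by rw [hc]; simp only [mul_assoc]
      _ = e := by rw [hw₁, hew, ← he, hee]
  have h₂ : (e * y * w' * e) * v = e := by
    calc (e * y * w' * e) * v = e * y * w' * (e * v) := by simp only [mul_assoc]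
      _ = e * (y * (w' * v * e)) := by rw [← hc]; simp only [mul_assoc]
      _ = e := by rw [hw₂, hwe, ← he', hee]
  have hb : e * (e * w' * x * e) = e * w' * x * e := by simp only [← mul_assoc, hee]
  have hbe : (e * y * w' * e) * e = e * y * w' * e := by rw [mul_assoc _ e e, hee]
  generalize e * w' * x * e = b at h₁ hb
  generalize e * y * w' * e = b' at h₂ hbe
  obtain rfl : b' = b := by rw [← hbe, ← h₁, ← mul_assoc, h₂, hb]
  refine ⟨b', h₁.trans h₂.symm, by rw [mul_assoc, h₁, hbe], n + 1, ?_⟩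
  have hi : IsIdempotentElem (1 - e) := IsIdempotentElem.one_sub hee
  have hc' : Commute v (1 - e) := (Commute.one_right v).sub_right hc
  rw [mul_assoc, h₁, ← mul_one_sub, hc'.mul_pow, hw, hi.pow_succ_eq, mul_one_sub, hwe, sub_self]

/-- Every element of a left and right artinian ring has a Drazin inverse. -/
lemma IsArtinianRing.exists_drazin_inverse {R : Type*} [Ring R] [IsArtinianRing R]
    [IsArtinianRing Rᵐᵒᵖ] (v : R) :
    ∃ b, v * b = b * v ∧ b * v * b = b ∧ IsNilpotent (v - v * v * b) := by
  obtain ⟨n₁, h₁⟩ := IsArtinianRing.exists_pow_eq_mul_pow v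
  obtain ⟨n₂, h₂⟩ := IsArtinianRing.exists_pow_eq_mul_pow (MulOpposite.op v)
  obtain ⟨y, hy⟩ := h₁ (n₁ + (n₁ + n₂ + 1)) (by omega)
  obtain ⟨x, hx⟩ := h₂ (n₂ + (n₁ + n₂ + 1)) (by omega)
  replace hx : v ^ n₂ = v ^ (n₂ + (n₁ + n₂ + 1)) * x.unop := by
    simpa using congrArg MulOpposite.unop hx
  refine exists_drazin_inverse_of_eq_mul (n := n₁ + n₂) (x := x.unop) (y := y) ?_ ?_
  · calc v ^ (n₁ + n₂ + 1) = v ^ (n₁ + 1) * v ^ n₂ := by rw [← pow_add]; congr 1; omega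
      _ = _ := by rw [hx, ← mul_assoc, ← pow_add, ← pow_add]; congr 2; omega
  · calc v ^ (n₁ + n₂ + 1) = v ^ n₁ * v ^ (n₂ + 1) := by rw [← pow_add]; congr 1
      _ = _ := by rw [hy, mul_assoc, ← pow_add, ← pow_add]; congr 2; omega

end DrazinInverse

section Fitting

variable {T : Type*} [Category T] [Preadditive T] [HasBinaryBiproducts T]

/-- Fitting decomposition of an endomorphism whose endomorphism ring is artinian. -/
lemma exists_fitting_decomposition [IsIdempotentComplete T] {X : T} [IsArtinianRing (End X)]
    [IsArtinianRing (End X)ᵐᵒᵖ] (v : End X) :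
    ∃ (A B : T) (e : X ≅ A ⊞ B) (a : A ≅ A) (b : End B),
      IsNilpotent b ∧ (v : X ⟶ X) ≫ e.hom = e.hom ≫ biprod.map a.hom (b : B ⟶ B) := by
  obtain ⟨d, hvd, hdvd, n, hn⟩ := IsArtinianRing.exists_drazin_inverse v
  let v' : X ⟶ X := v
  let d' : X ⟶ X := d
  have comm : d' ≫ v' = v' ≫ d' := hvd
  have hd : d' ≫ v' ≫ d' = d' := hdvd
  have hp : (v' ≫ d') ≫ (v' ≫ d') = v' ≫ d' := by rw [Category.assoc, hd]
  obtain ⟨A, j, q, hjq, hqj⟩ := IsIdempotentComplete.idempotents_split X _ hp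
  obtain ⟨B, i, r, hir, hri⟩ := IsIdempotentComplete.idempotents_split X (𝟙 X - v' ≫ d')
    (by simp only [Preadditive.sub_comp, Preadditive.comp_sub, Category.id_comp,
          Category.comp_id, hp, sub_self, sub_zero])
  have hsum : q ≫ j + r ≫ i = 𝟙 X := by rw [hqj, hri]; abel
  have hjr : j ≫ r = 0 := by
    have : j ≫ (q ≫ j + r ≫ i) ≫ r = j ≫ r := by rw [hsum, Category.id_comp]
    simpa [reassoc_of% hjq, hir] using this
  have hiq : i ≫ q = 0 := by
    have : i ≫ (q ≫ j + r ≫ i) ≫ q = i ≫ q := by rw [hsum, Category.id_comp]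
    simpa [reassoc_of% hir, hjq] using this
  have hcq : v' ≫ q ≫ j = (q ≫ j) ≫ v' := by rw [hqj, Category.assoc, comm]
  have hcr : v' ≫ r ≫ i = (r ≫ i) ≫ v' := by
    rw [hri, Preadditive.comp_sub, Preadditive.sub_comp, Category.assoc, comm,
      Category.comp_id, Category.id_comp]
  have hcd : d' ≫ q ≫ j = (q ≫ j) ≫ d' := by
    rw [hqj, ← Category.assoc, comm]
  let a : A ≅ A :=
    { hom := j ≫ v' ≫ q
      inv := j ≫ d' ≫ q
      hom_inv_id := by
        calc (j ≫ v' ≫ q) ≫ j ≫ d' ≫ q = j ≫ (v' ≫ q ≫ j) ≫ d' ≫ q := by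
              simp only [Category.assoc]
          _ = j ≫ (q ≫ j) ≫ (v' ≫ d') ≫ q := by rw [hcq]; simp only [Category.assoc]
          _ = 𝟙 A := by simp only [← hqj, Category.assoc, hjq, Category.comp_id]
      inv_hom_id := by
        calc (j ≫ d' ≫ q) ≫ j ≫ v' ≫ q = j ≫ (d' ≫ q ≫ j) ≫ v' ≫ q := by
              simp only [Category.assoc]
          _ = j ≫ (q ≫ j) ≫ (d' ≫ v') ≫ q := by rw [hcd]; simp only [Category.assoc]
          _ = 𝟙 A := by simp only [comm, ← hqj, Category.assoc, hjq, Category.comp_id] }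
  let b : End B := i ≫ v' ≫ r
  refine ⟨A, B, ⟨biprod.lift q r, biprod.desc j i, ?_, ?_⟩, a, b, ⟨n, ?_⟩, ?_⟩
  · rw [biprod.lift_desc, hsum]
  · ext <;> simp [hjq, hir, hjr, hiq]
  · let t : End X := v - v * v * d
    have hit : i ≫ (t : X ⟶ X) = (b : B ⟶ B) ≫ i := by
      have ht : (t : X ⟶ X) = v' ≫ r ≫ i := by
        rw [hri, Preadditive.comp_sub, Category.comp_id, ← comm, ← Category.assoc, ← comm]
        change v' - d' ≫ v' ≫ v' = v' - _
        rw [Category.assoc]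
      simp [ht, b]
    change t ^ n = 0 at hn
    clear_value t b
    have hpow : ∀ k : ℕ, i ≫ ((t ^ k : End X) : X ⟶ X) = ((b ^ k : End B) : B ⟶ B) ≫ i := by
      intro k
      induction k with
      | zero => exact (Category.comp_id i).trans (Category.id_comp i).symm
      | succ k ih =>
        rw [pow_succ, pow_succ, End.mul_def, End.mul_def, ← Category.assoc, hit, Category.assoc,
          ih, Category.assoc]
    have h0 : ((b ^ n : End B) : B ⟶ B) ≫ i = 0 := by
      rw [← hpow, hn]; exact comp_zero
    calc ((b ^ n : End B) : B ⟶ B) = (((b ^ n : End B) : B ⟶ B) ≫ i) ≫ r := by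
          rw [Category.assoc, hir, Category.comp_id]
      _ = 0 := by rw [h0, zero_comp]
  · change v' ≫ biprod.lift q r = biprod.lift q r ≫ biprod.map (j ≫ v' ≫ q) (i ≫ v' ≫ r)
    ext
    · simp only [Category.assoc, biprod.lift_fst, biprod.map_fst, biprod.lift_fst_assoc]
      rw [← Category.assoc q, ← Category.assoc (q ≫ j), ← hcq, Category.assoc, Category.assoc, hjq,
        Category.comp_id]
    · simp only [Category.assoc, biprod.lift_snd, biprod.map_snd, biprod.lift_snd_assoc]
      rw [← Category.assoc r, ← Category.assoc (r ≫ i), ← hcr, Category.assoc, Category.assoc, hir,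
        Category.comp_id]

end Fitting

section

open ZeroObject

variable {T : Type*} [Category T] [Preadditive T] [HasZeroObject T] [HasBinaryBiproducts T]

/-- The automorphism of `(W ⊞ M) ⊞ M` interchanging the two copies of `M`. -/
noncomputable def biprodSwapRight (W M : T) : (W ⊞ M) ⊞ M ≅ (W ⊞ M) ⊞ M where
  hom := biprod.lift (biprod.lift (biprod.fst ≫ biprod.fst) biprod.snd) (biprod.fst ≫ biprod.snd)
  inv := biprod.lift (biprod.lift (biprod.fst ≫ biprod.fst) biprod.snd) (biprod.fst ≫ biprod.snd)

/-- The automorphism of `M ⊞ (M ⊞ W)` interchanging the two copies of `M`. -/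
noncomputable def biprodSwapLeft (W M : T) : M ⊞ (M ⊞ W) ≅ M ⊞ (M ⊞ W) where
  hom := biprod.desc (biprod.inl ≫ biprod.inr) (biprod.desc biprod.inl (biprod.inr ≫ biprod.inr))
  inv := biprod.desc (biprod.inl ≫ biprod.inr) (biprod.desc biprod.inl (biprod.inr ≫ biprod.inr))

lemma exists_iso_lift_pow {Z M : T} (v : End Z) (u : Z ⟶ M) (k : ℕ) :
    ∃ (W : T) (p : Z ⟶ W) (e : W ⊞ M ≅ W ⊞ M),
      biprod.lift ((v : Z ⟶ Z) ≫ p) u ≫ e.hom =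
        biprod.lift p (((v ^ k : End Z) : Z ⟶ Z) ≫ u) := by
  induction k with
  | zero =>
    refine ⟨0, 0, Iso.refl _, ?_⟩
    ext
    simp [End.one_def]
  | succ k ih =>
    obtain ⟨W, p, e, he⟩ := ih
    have h₁ := (v : Z ⟶ Z) ≫= (he =≫ biprod.fst)
    have h₂ := (v : Z ⟶ Z) ≫= (he =≫ biprod.snd)
    rw [Category.assoc, biprod.lift_fst] at h₁
    rw [Category.assoc, biprod.lift_snd] at h₂
    refine ⟨W ⊞ M, biprod.lift ((v : Z ⟶ Z) ≫ p) u,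
      biprod.mapIso e (Iso.refl M) ≪≫ biprodSwapRight W M, ?_⟩
    ext
    · simpa [biprodSwapRight] using h₁
    · simp [biprodSwapRight]
    · simpa [biprodSwapRight, pow_succ, End.mul_def] using h₂

lemma exists_iso_desc_pow {Z M : T} (v : End Z) (u : M ⟶ Z) (k : ℕ) :
    ∃ (W : T) (p : W ⟶ Z) (e : M ⊞ W ≅ M ⊞ W),
      e.hom ≫ biprod.desc u (p ≫ (v : Z ⟶ Z)) =
        biprod.desc (u ≫ ((v ^ k : End Z) : Z ⟶ Z)) p := by
  induction k with
  | zero =>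
    refine ⟨0, 0, Iso.refl _, ?_⟩
    ext
    simp [End.one_def]
  | succ k ih =>
    obtain ⟨W, p, e, he⟩ := ih
    have h₁ := (biprod.inl ≫= he) =≫ (v : Z ⟶ Z)
    have h₂ := (biprod.inr ≫= he) =≫ (v : Z ⟶ Z)
    rw [biprod.inl_desc] at h₁
    rw [biprod.inr_desc] at h₂
    refine ⟨M ⊞ W, biprod.desc u (p ≫ (v : Z ⟶ Z)),
      biprodSwapLeft W M ≪≫ biprod.mapIso (Iso.refl M) e, ?_⟩
    ext
    · simpa [biprodSwapLeft, pow_succ', End.mul_def] using h₁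
    · simp [biprodSwapLeft]
    · simpa [biprodSwapLeft] using h₂

end

section

variable {T : Type*} [Category T] [Preadditive T] [HasZeroObject T]
  [HasShift T ℤ] [∀ n : ℤ, (CategoryTheory.shiftFunctor T n).Additive] [Pretriangulated T]

/-- Two composable morphisms which are the first two morphisms of a distinguished triangle. -/
def IsDistinguishedPair {X Y Z : T} (f : X ⟶ Y) (g : Y ⟶ Z) : Prop :=
  ∃ h : Z ⟶ X⟦(1 : ℤ)⟧, Triangle.mk f g h ∈ distTriang T

namespace IsDistinguishedPair

lemma exists_cone {X Y : T} (f : X ⟶ Y) : ∃ (Z : T) (g : Y ⟶ Z), IsDistinguishedPair f g := by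
  obtain ⟨Z, g, h, H⟩ := distinguished_cocone_triangle f
  exact ⟨Z, g, h, H⟩

lemma exists_fiber {Y Z : T} (g : Y ⟶ Z) : ∃ (X : T) (f : X ⟶ Y), IsDistinguishedPair f g := by
  obtain ⟨X, f, h, H⟩ := distinguished_cocone_triangle₁ g
  exact ⟨X, f, h, H⟩

lemma id_zero (X : T) {Z : T} (hZ : IsZero Z) (g : X ⟶ Z) : IsDistinguishedPair (𝟙 X) g :=
  ⟨0, (Triangle.distinguished_iff_of_isZero₃ _ hZ).2 (inferInstanceAs (IsIso (𝟙 X)))⟩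

lemma zero_id (X : T) {Z : T} (hZ : IsZero Z) (f : Z ⟶ X) : IsDistinguishedPair f (𝟙 X) :=
  ⟨0, (Triangle.distinguished_iff_of_isZero₁ _ hZ).2 (inferInstanceAs (IsIso (𝟙 X)))⟩

lemma of_iso {X Y Z X' Y' Z' : T} {f : X ⟶ Y} {g : Y ⟶ Z} {f' : X' ⟶ Y'} {g' : Y' ⟶ Z'}
    (H : IsDistinguishedPair f g) (e₁ : X ≅ X') (e₂ : Y ≅ Y') (e₃ : Z ≅ Z')
    (h₁ : f ≫ e₂.hom = e₁.hom ≫ f') (h₂ : g ≫ e₃.hom = e₂.hom ≫ g') :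
    IsDistinguishedPair f' g' := by
  obtain ⟨h, H⟩ := H
  refine ⟨e₃.inv ≫ h ≫ e₁.hom⟦(1 : ℤ)⟧', isomorphic_distinguished _ H _ ?_⟩
  exact (Triangle.isoMk (Triangle.mk f g h) (Triangle.mk f' g' _) e₁ e₂ e₃ h₁ h₂
    (e₃.hom_inv_id_assoc _).symm).symm

lemma exists_iso_cone {X Y Z Z' : T} {f : X ⟶ Y} {g : Y ⟶ Z} {g' : Y ⟶ Z'}
    (H : IsDistinguishedPair f g) (H' : IsDistinguishedPair f g') : Nonempty (Z ≅ Z') := by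
  obtain ⟨h, H⟩ := H
  obtain ⟨h', H'⟩ := H'
  exact ⟨Triangle.π₃.mapIso
    (isoTriangleOfIso₁₂ _ _ H H' (Iso.refl X) (Iso.refl Y)
      ((Category.comp_id f).trans (Category.id_comp f).symm))⟩

lemma rotate {X Y Z : T} {f : X ⟶ Y} {g : Y ⟶ Z} (H : IsDistinguishedPair f g) :
    ∃ h : Z ⟶ X⟦(1 : ℤ)⟧, IsDistinguishedPair g h := by
  obtain ⟨h, H⟩ := H
  exact ⟨h, _, rot_of_distTriang _ H⟩

lemma exists_of_rotate {X Y Z : T} {g : Y ⟶ Z} {h : Z ⟶ X⟦(1 : ℤ)⟧}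
    (H : IsDistinguishedPair g h) : ∃ f : X ⟶ Y, IsDistinguishedPair f g := by
  obtain ⟨k, H⟩ := H
  obtain ⟨f, hf⟩ := (shiftFunctor T (1 : ℤ)).map_surjective k
  refine ⟨-f, h, (rotate_distinguished_triangle _).2 ?_⟩
  have : (Triangle.mk (-f) g h).rotate = Triangle.mk g h k := by
    rw [← hf, ← neg_neg ((shiftFunctor T (1 : ℤ)).map f), ← Functor.map_neg]
    rfl
  rw [this]
  exact H

lemma exists_iso_fiber {X X' Y Z : T} {f : X ⟶ Y} {f' : X' ⟶ Y} {g : Y ⟶ Z}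
    (H : IsDistinguishedPair f g) (H' : IsDistinguishedPair f' g) : Nonempty (X ≅ X') := by
  obtain ⟨h, H⟩ := H.rotate
  obtain ⟨h', H'⟩ := H'.rotate
  obtain ⟨e⟩ := exists_iso_cone H H'
  exact ⟨(shiftFunctor T (1 : ℤ)).preimageIso e⟩

lemma exists_octahedron [IsTriangulated T] {X₁ X₂ X₃ Z₁₂ Z₂₃ Z₁₃ : T}
    {u₁₂ : X₁ ⟶ X₂} {u₂₃ : X₂ ⟶ X₃} {u₁₃ : X₁ ⟶ X₃} (comm : u₁₂ ≫ u₂₃ = u₁₃)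
    {v₁₂ : X₂ ⟶ Z₁₂} {v₂₃ : X₃ ⟶ Z₂₃} {v₁₃ : X₃ ⟶ Z₁₃}
    (h₁₂ : IsDistinguishedPair u₁₂ v₁₂) (h₂₃ : IsDistinguishedPair u₂₃ v₂₃)
    (h₁₃ : IsDistinguishedPair u₁₃ v₁₃) :
    ∃ (a : Z₁₂ ⟶ Z₁₃) (b : Z₁₃ ⟶ Z₂₃), IsDistinguishedPair a b := by
  obtain ⟨_, h₁₂⟩ := h₁₂
  obtain ⟨_, h₂₃⟩ := h₂₃
  obtain ⟨_, h₁₃⟩ := h₁₃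
  let o := Triangulated.someOctahedron comm h₁₂ h₂₃ h₁₃
  exact ⟨o.m₁, o.m₃, _, o.mem⟩

lemma exists_octahedron_fiber [IsTriangulated T] {X₁ X₂ X₃ Z₁₂ Z₂₃ Z₁₃ : T}
    {u₁₂ : X₁ ⟶ X₂} {u₂₃ : X₂ ⟶ X₃} {u₁₃ : X₁ ⟶ X₃} (comm : u₁₂ ≫ u₂₃ = u₁₃)
    {v₁₂ : Z₁₂ ⟶ X₁} {v₂₃ : Z₂₃ ⟶ X₂} {v₁₃ : Z₁₃ ⟶ X₁}
    (h₁₂ : IsDistinguishedPair v₁₂ u₁₂) (h₂₃ : IsDistinguishedPair v₂₃ u₂₃)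
    (h₁₃ : IsDistinguishedPair v₁₃ u₁₃) :
    ∃ (a : Z₁₂ ⟶ Z₁₃) (b : Z₁₃ ⟶ Z₂₃), IsDistinguishedPair a b := by
  obtain ⟨_, h₁₂⟩ := h₁₂.rotate
  obtain ⟨_, h₂₃⟩ := h₂₃.rotate
  obtain ⟨_, h₁₃⟩ := h₁₃.rotate
  obtain ⟨_, _, H⟩ := exists_octahedron comm h₁₂ h₂₃ h₁₃
  obtain ⟨_, H⟩ := exists_of_rotate H
  obtain ⟨_, H⟩ := exists_of_rotate H
  obtain ⟨a, H⟩ := exists_of_rotate H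
  exact ⟨a, _, H⟩

/-- The biproduct of two objects is the product of the corresponding family indexed by `Bool`. -/
noncomputable def biprodIsoPi (F : Bool → T) : ∏ᶜ F ≅ F true ⊞ F false where
  hom := biprod.lift (Pi.π F true) (Pi.π F false)
  inv := Pi.lift fun
    | true => biprod.fst
    | false => biprod.snd
  hom_inv_id := by
    ext b
    cases b <;> simp
  inv_hom_id := by ext <;> simp

lemma map_biprodIsoPi_hom {F G : Bool → T} (φ : ∀ b, F b ⟶ G b) :
    Limits.Pi.map φ ≫ (biprodIsoPi G).hom =
      (biprodIsoPi F).hom ≫ biprod.map (φ true) (φ false) := by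
  dsimp only [biprodIsoPi]
  ext <;> simp

lemma biprod_map {X Y Z X' Y' Z' : T} {f : X ⟶ Y} {g : Y ⟶ Z} {f' : X' ⟶ Y'} {g' : Y' ⟶ Z'}
    (H : IsDistinguishedPair f g) (H' : IsDistinguishedPair f' g') :
    IsDistinguishedPair (biprod.map f f') (biprod.map g g') := by
  obtain ⟨h, H⟩ := H
  obtain ⟨h', H'⟩ := H'
  let F : Bool → Triangle T
    | true => Triangle.mk f g h
    | false => Triangle.mk f' g' h'
  have hF := productTriangle_distinguished F (by rintro (_ | _) <;> assumption)
  have hP : IsDistinguishedPair (Limits.Pi.map (fun j => (F j).mor₁))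
    (Limits.Pi.map (fun j => (F j).mor₂)) := ⟨_, hF⟩
  exact hP.of_iso _ _ _ (map_biprodIsoPi_hom fun j => (F j).mor₁)
    (map_biprodIsoPi_hom fun j => (F j).mor₂)

end IsDistinguishedPair

end

section

open ZeroObject

variable {T : Type*} [Category T] [Preadditive T] [HasZeroObject T]
  [HasShift T ℤ] [∀ n : ℤ, (CategoryTheory.shiftFunctor T n).Additive] [Pretriangulated T]

/-- The isomorphism of `X ⊞ 0` with `X` for a zero object `0`. -/
noncomputable def biprodZeroIso (X : T) {Z : T} (hZ : IsZero Z) : X ⊞ Z ≅ X where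
  hom := biprod.fst
  inv := biprod.inl
  hom_inv_id := by
    ext
    · simp
    · simp
    · exact hZ.eq_of_src _ _
    · exact hZ.eq_of_src _ _

namespace IsDistinguishedPair

lemma exists_right_of_left [IsTriangulated T] {Z M N : T} {v : End Z} {u : Z ⟶ M}
    (hv : IsNilpotent v) {g : Z ⊞ M ⟶ N}
    (H : IsDistinguishedPair (biprod.lift (v : Z ⟶ Z) u) g) :
    ∃ (C : T) (u' : M ⟶ C) (v' : C ⟶ C) (f : N ⟶ M ⊞ C),
      IsDistinguishedPair f (biprod.desc u' v') := by
  obtain ⟨k, hk⟩ := hv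
  obtain ⟨W, p, e, he⟩ := exists_iso_lift_pow v u k
  rw [hk, show ((0 : End Z) : Z ⟶ Z) ≫ u = 0 from zero_comp] at he
  obtain ⟨C, q, hq⟩ := exists_cone p
  have h₂₃ := hq.biprod_map (id_zero M (isZero_zero T) 0)
  have h₁₃ := (hq.biprod_map (zero_id M (isZero_zero T) 0)).of_iso
    (g' := e.hom ≫ biprod.map q (𝟙 M)) (f' := biprod.lift ((v : Z ⟶ Z) ≫ p) u)
    (biprodZeroIso Z (isZero_zero T)) e.symm (Iso.refl _)
    (by
      rw [Iso.symm_hom, Iso.comp_inv_eq, Category.assoc, he]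
      ext <;> simp [biprodZeroIso])
    (by simp)
  obtain ⟨a, b, hab⟩ := exists_octahedron (by ext <;> simp) H h₂₃ h₁₃
  let s : C ⊞ M ≅ M ⊞ C := biprod.braiding C M
  refine ⟨C, biprod.inr ≫ b ≫ biprod.fst, biprod.inl ≫ b ≫ biprod.fst, a ≫ s.hom,
    hab.of_iso (Iso.refl N) s (biprodZeroIso C (isZero_zero T)) (by simp) ?_⟩
  ext <;> simp [s, biprodZeroIso]

lemma exists_left_of_right [IsTriangulated T] {Z M N : T} {v : End Z} {u : M ⟶ Z}
    (hv : IsNilpotent v) {f : N ⟶ M ⊞ Z}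
    (H : IsDistinguishedPair f (biprod.desc u (v : Z ⟶ Z))) :
    ∃ (C : T) (u' : C ⟶ M) (v' : C ⟶ C) (g : C ⊞ M ⟶ N),
      IsDistinguishedPair (biprod.lift v' u') g := by
  obtain ⟨k, hk⟩ := hv
  obtain ⟨W, p, e, he⟩ := exists_iso_desc_pow v u k
  rw [hk, show u ≫ ((0 : End Z) : Z ⟶ Z) = 0 from comp_zero] at he
  obtain ⟨C, q, hq⟩ := exists_fiber p
  have h₁₂ := hq.biprod_map (zero_id M (isZero_zero T) 0)
  have h₁₃ := (hq.biprod_map (id_zero M (isZero_zero T) 0)).of_iso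
    (f' := biprod.map q (𝟙 M) ≫ (biprod.braiding W M).hom ≫ e.hom)
    (g' := biprod.desc u (p ≫ (v : Z ⟶ Z)))
    (Iso.refl _) (biprod.braiding W M ≪≫ e) (biprodZeroIso Z (isZero_zero T))
    (by simp)
    (by
      rw [Iso.trans_hom, Category.assoc, he]
      ext <;> simp [biprodZeroIso])
  have h₂₃ := H.of_iso (Iso.refl _) (biprod.braiding M Z) (Iso.refl _)
    (f' := f ≫ (biprod.braiding M Z).hom) (g' := biprod.desc (v : Z ⟶ Z) u)
    (by simp) (by ext <;> simp)
  replace h₁₃ := h₁₃.of_iso (Iso.refl _) (biprod.braiding M W) (Iso.refl _)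
    (f' := (biprod.map q (𝟙 M) ≫ (biprod.braiding W M).hom ≫ e.hom) ≫ (biprod.braiding M W).hom)
    (g' := biprod.desc (p ≫ (v : Z ⟶ Z)) u)
    (by simp) (by ext <;> simp)
  obtain ⟨a, b, hab⟩ := exists_octahedron_fiber (by ext <;> simp) h₁₂ h₂₃ h₁₃
  refine ⟨C, biprod.inl ≫ a ≫ biprod.snd, biprod.inl ≫ a ≫ biprod.fst, b,
    hab.of_iso (biprodZeroIso C (isZero_zero T)) (Iso.refl _) (Iso.refl _) ?_ (by simp)⟩
  ext <;> simp [biprodZeroIso]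

lemma exists_desc_nilpotent [IsIdempotentComplete T] {M N C : T} [IsArtinianRing (End C)]
    [IsArtinianRing (End C)ᵐᵒᵖ] {u : M ⟶ C} {v : C ⟶ C} {f : N ⟶ M ⊞ C}
    (H : IsDistinguishedPair f (biprod.desc u v)) :
    ∃ (B : T) (u' : M ⟶ B) (v' : End B) (f' : N ⟶ M ⊞ B), IsNilpotent v' ∧
      IsDistinguishedPair f' (biprod.desc u' (v' : B ⟶ B)) := by
  obtain ⟨A, B, e, a, b, hb, hv⟩ := exists_fitting_decomposition (v : End C)
  obtain ⟨N', f', H'⟩ := exists_fiber (biprod.desc (u ≫ e.hom ≫ biprod.snd) (b : B ⟶ B))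
  have hv₁ : v ≫ e.hom ≫ biprod.fst = e.hom ≫ biprod.fst ≫ a.hom := by
    simpa using hv =≫ biprod.fst
  have hv₂ : v ≫ e.hom ≫ biprod.snd = e.hom ≫ biprod.snd ≫ (b : B ⟶ B) := by
    simpa using hv =≫ biprod.snd
  have hv₁' : v ≫ e.hom ≫ biprod.fst ≫ a.inv = e.hom ≫ biprod.fst := by
    simpa using hv₁ =≫ a.inv
  let φ : M ⊞ C ≅ (M ⊞ B) ⊞ A :=
    { hom := biprod.lift (biprod.map (𝟙 M) (e.hom ≫ biprod.snd))
        (biprod.desc u v ≫ e.hom ≫ biprod.fst)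
      inv := biprod.lift (biprod.fst ≫ biprod.fst)
        (biprod.lift ((biprod.snd - biprod.fst ≫ biprod.fst ≫ u ≫ e.hom ≫ biprod.fst) ≫ a.inv)
          (biprod.fst ≫ biprod.snd) ≫ e.inv)
      hom_inv_id := by
        rw [← cancel_mono (biprod.mapIso (Iso.refl M) e).hom]
        ext <;> simp [hv₁']
      inv_hom_id := by
        ext <;> simp [hv₁] }
  have H₁ := H.of_iso (Iso.refl N) φ (e ≪≫ biprod.braiding A B) (f' := f ≫ φ.hom)
    (g' := biprod.map (biprod.desc (u ≫ e.hom ≫ biprod.snd) (b : B ⟶ B)) (𝟙 A))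
    (by simp) (by ext <;> simp [φ, hv₁, hv₂])
  obtain ⟨i⟩ := exists_iso_fiber H₁ (H'.biprod_map (zero_id A (isZero_zero T) 0))
  let j : N ≅ N' := i ≪≫ biprodZeroIso N' (isZero_zero T)
  exact ⟨B, u ≫ e.hom ≫ biprod.snd, b, j.hom ≫ f', hb,
    H'.of_iso j.symm (Iso.refl _) (Iso.refl _) (by simp) (by simp)⟩

lemma exists_lift_nilpotent [IsIdempotentComplete T] {M N C : T} [IsArtinianRing (End C)]
    [IsArtinianRing (End C)ᵐᵒᵖ] {u : C ⟶ M} {v : C ⟶ C} {g : C ⊞ M ⟶ N}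
    (H : IsDistinguishedPair (biprod.lift v u) g) :
    ∃ (B : T) (u' : B ⟶ M) (v' : End B) (g' : B ⊞ M ⟶ N), IsNilpotent v' ∧
      IsDistinguishedPair (biprod.lift (v' : B ⟶ B) u') g' := by
  obtain ⟨A, B, e, a, b, hb, hv⟩ := exists_fitting_decomposition (v : End C)
  obtain ⟨N', g', H'⟩ := exists_cone (biprod.lift (b : B ⟶ B) (biprod.inr ≫ e.inv ≫ u))
  replace hv : e.inv ≫ v = biprod.map a.hom (b : B ⟶ B) ≫ e.inv := by
    rw [Iso.inv_comp_eq, ← Category.assoc, Iso.eq_comp_inv]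
    exact hv
  have hv₁ : biprod.inl ≫ e.inv ≫ v = a.hom ≫ biprod.inl ≫ e.inv := by
    simpa using biprod.inl ≫= hv
  have hv₂ : biprod.inr ≫ e.inv ≫ v = (b : B ⟶ B) ≫ biprod.inr ≫ e.inv := by
    simpa using biprod.inr ≫= hv
  have hv₁' : a.inv ≫ biprod.inl ≫ e.inv ≫ v = biprod.inl ≫ e.inv := by
    rw [hv₁, Iso.inv_hom_id_assoc]
  let φ : (B ⊞ M) ⊞ A ≅ C ⊞ M :=
    { hom := biprod.desc (biprod.map (biprod.inr ≫ e.inv) (𝟙 M))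
        (biprod.inl ≫ e.inv ≫ biprod.lift v u)
      inv := biprod.desc
        (e.hom ≫ biprod.desc
          (a.inv ≫ (biprod.inr - biprod.inl ≫ e.inv ≫ u ≫ biprod.inr ≫ biprod.inl))
          (biprod.inl ≫ biprod.inl))
        (biprod.inr ≫ biprod.inl)
      hom_inv_id := by
        ext <;> simp [reassoc_of% hv₁]
      inv_hom_id := by
        rw [← cancel_epi (biprod.mapIso e (Iso.refl M)).inv]
        ext <;> simp [hv₁'] }
  have hs₁ : biprod.inl ≫ biprod.lift biprod.snd biprod.fst = (biprod.inr : A ⟶ B ⊞ A) := by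
    ext <;> simp
  have hs₂ : biprod.inr ≫ biprod.lift biprod.snd biprod.fst = (biprod.inl : B ⟶ B ⊞ A) := by
    ext <;> simp
  have H₁ := H.of_iso (e ≪≫ biprod.braiding A B) φ.symm (Iso.refl N) (g' := φ.hom ≫ g)
    (f' := biprod.map (biprod.lift (b : B ⟶ B) (biprod.inr ≫ e.inv ≫ u)) (𝟙 A))
    (by
      rw [Iso.symm_hom, Iso.comp_inv_eq, ← cancel_epi e.inv]
      ext <;> simp [φ, hv₁, hv₂, reassoc_of% hs₁, reassoc_of% hs₂]) (by simp)
  obtain ⟨i⟩ := exists_iso_cone H₁ (H'.biprod_map (id_zero A (isZero_zero T) 0))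
  let j : N ≅ N' := i ≪≫ biprodZeroIso N' (isZero_zero T)
  exact ⟨B, biprod.inr ≫ e.inv ≫ u, b, g' ≫ j.inv, hb,
    H'.of_iso (Iso.refl _) (Iso.refl _) j.symm (by simp) (by simp)⟩

end IsDistinguishedPair

end

/-- **Theorem (main theorem, case (a)).** Let `K` be a commutative ring and `T` a `K`-linear
triangulated category in which idempotents split and all endomorphism rings are left and right
artinian. Then the "left" and "right" versions of nilpotent triangle degeneration agree. -/
theorem left_degeneration_iff_right_degeneration
    (K : Type*) [CommRing K]
    (T : Type*) [Category T] [Preadditive T] [Linear K T] [HasZeroObject T]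
    [HasShift T ℤ] [∀ n : ℤ, (CategoryTheory.shiftFunctor T n).Additive]
    [Pretriangulated T] [IsTriangulated T]
    [IsIdempotentComplete T]
    (hart : ∀ X : T, IsArtinianRing (End X) ∧ IsArtinianRing (End X)ᵐᵒᵖ)
    (M N : T) :
    (∃ (Zl : T) (ul : Zl ⟶ M) (vl : End Zl)
        (g : Zl ⊞ M ⟶ N) (h : N ⟶ Zl⟦(1 : ℤ)⟧),
        IsNilpotent vl ∧
        Triangle.mk (biprod.lift (vl : Zl ⟶ Zl) ul) g h ∈ distTriang T) ↔
    (∃ (Zr : T) (ur : M ⟶ Zr) (vr : End Zr)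
        (f : N ⟶ M ⊞ Zr) (h : Zr ⟶ N⟦(1 : ℤ)⟧),
        IsNilpotent vr ∧
        Triangle.mk f (biprod.desc ur (vr : Zr ⟶ Zr)) h ∈ distTriang T) := by
  have hl : ∀ X : T, IsArtinianRing (End X) := fun X => (hart X).1
  have hr : ∀ X : T, IsArtinianRing (End X)ᵐᵒᵖ := fun X => (hart X).2
  constructor
  · rintro ⟨Z, u, v, g, h, hv, H⟩
    obtain ⟨C, u', v', f, H'⟩ := IsDistinguishedPair.exists_right_of_left hv ⟨h, H⟩
    obtain ⟨B, u'', v'', f', hv', h', H''⟩ := H'.exists_desc_nilpotent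
    exact ⟨B, u'', v'', f', h', hv', H''⟩
  · rintro ⟨Z, u, v, f, h, hv, H⟩
    obtain ⟨C, u', v', g, H'⟩ := IsDistinguishedPair.exists_left_of_right hv ⟨h, H⟩
    obtain ⟨B, u'', v'', g', hv', h', H''⟩ := H'.exists_lift_nilpotent
    exact ⟨B, u'', v'', g', h', hv', H''⟩
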